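/- For every n ∈ ℤ and every z ∈ ℂ, the Bargmann transform of φₙ equals ψₙ: (ν/π)^{3/4} · 2^{−1/4} ∫_ℝ e^{−(ν/2)(z² + q²) + ν√2 z q + √2 πi(n+α)q} dq = (2ν/π)^{1/4} e^{−(π²/ν)(n+α)²} e^{(ν/2)z² + 2πi(α+n)z}. -/

import Mathlib

open Complex MeasureTheory

lemma bargmann_normalization {ν : ℝ} (hν : 0 < ν) :
    (ν / Real.pi) ^ ((3 : ℝ) / 4) * 2 ^ (-(1 : ℝ) / 4) * (2 * Real.pi / ν) ^ ((1 : ℝ) / 2) =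
      (2 * ν / Real.pi) ^ ((1 : ℝ) / 4) := by
  have hr : 0 < ν / Real.pi := div_pos hν Real.pi_pos
  have h₁ : 2 * Real.pi / ν = 2 * (ν / Real.pi)⁻¹ := by rw [inv_div, mul_div_assoc]
  rw [h₁, mul_div_assoc, Real.mul_rpow zero_le_two (inv_nonneg.2 hr.le),
    Real.mul_rpow zero_le_two hr.le, Real.inv_rpow hr.le, ← Real.rpow_neg hr.le,
    mul_comm (_ ^ (3 / 4 : ℝ)), mul_mul_mul_comm, ← Real.rpow_add hr, ← Real.rpow_add two_pos]
  norm_num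

/-- The Bargmann transform of `φₙ(q) = 2^{−1/4} e^{√2 πi(n+α)q}` equals
`ψₙ(z) = (2ν/π)^{1/4} e^{−(π²/ν)(n+α)²} e^{(ν/2)z² + 2πi(α+n)z}`:
`(ν/π)^{3/4} 2^{−1/4} ∫_ℝ e^{−(ν/2)(z²+q²) + ν√2 zq + √2 πi(n+α)q} dq = ψₙ(z)`. -/
theorem stmt_11 (α ν : ℝ) (hν : 0 < ν) (n : ℤ) (z : ℂ) :
    ((((ν / Real.pi) ^ ((3 : ℝ) / 4) * 2 ^ (-(1 : ℝ) / 4) : ℝ)) : ℂ) *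
        ∫ q : ℝ, Complex.exp (-(ν / 2) * (z ^ 2 + (q : ℂ) ^ 2) +
            ν * Real.sqrt 2 * z * q + Real.sqrt 2 * Real.pi * Complex.I * (α + n) * q)
      = (((2 * ν / Real.pi) ^ ((1 : ℝ) / 4) *
            Real.exp (-(Real.pi ^ 2 / ν) * (n + α) ^ 2) : ℝ) : ℂ) *
          Complex.exp (ν / 2 * z ^ 2 + 2 * Real.pi * Complex.I * (α + n) * z) := by
  have hν' : (ν : ℂ) ≠ 0 := ofReal_ne_zero.2 hν.ne'
  have h_sqrt : ((Real.sqrt 2 : ℝ) : ℂ) ^ 2 = 2 := by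
    rw [← ofReal_pow, Real.sq_sqrt zero_le_two, ofReal_ofNat]
  have h_re : (-(ν / 2 : ℂ)).re < 0 := by
    rw [← ofReal_ofNat, ← ofReal_div, ← ofReal_neg, ofReal_re]
    linarith
  have h_integrand (q : ℝ) : -(ν / 2 : ℂ) * (z ^ 2 + (q : ℂ) ^ 2) + ν * Real.sqrt 2 * z * q +
      Real.sqrt 2 * Real.pi * I * (α + n) * q = -(ν / 2 : ℂ) * (q : ℂ) ^ 2 +
        Real.sqrt 2 * (ν * z + Real.pi * I * (α + n)) * q + -(ν / 2 : ℂ) * z ^ 2 := by ring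
  have h_exponent : -(ν / 2 : ℂ) * z ^ 2 -
      (Real.sqrt 2 * (ν * z + Real.pi * I * (α + n))) ^ 2 / (4 * -(ν / 2 : ℂ)) =
      ((-(Real.pi ^ 2 / ν) * (n + α) ^ 2 : ℝ) : ℂ) +
        (ν / 2 * z ^ 2 + 2 * Real.pi * I * (α + n) * z) := by
    rw [mul_pow, h_sqrt]
    push_cast
    field_simp
    linear_combination 8 * (Real.pi : ℂ) ^ 2 * (α + n) ^ 2 * I_sq
  have h_gauss : ((Real.pi : ℂ) / - -(ν / 2 : ℂ)) ^ (1 / 2 : ℂ) =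
      (((2 * Real.pi / ν) ^ ((1 : ℝ) / 2) : ℝ) : ℂ) := by
    rw [ofReal_cpow (by positivity)]
    push_cast
    congr 1
    field_simp
  simp_rw [h_integrand]
  rw [integral_cexp_quadratic h_re, h_exponent, h_gauss, Complex.exp_add, ← ofReal_exp, ← mul_assoc,
    ← mul_assoc, ← ofReal_mul, bargmann_normalization hν, ← ofReal_mul]
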